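/- Under Assumptions (A) and (B) with completely symmetric routing (p_{ij} = p for all i ≠ j, 0 < p < 1/(d−1)), let γ = (γ_1,…,γ_d) satisfy Σ(γ_1,…,γ_d) < 1 and 0 < γ_i < μ_i/ν_i − 1 for all i. Then the function h_γ(x) = Σ_{i=1}^d (1+γ_i)^{x^i} (1 + qγ_i)^{Σ_{j≠i} x^j} satisfies limsup_{|x|→∞, x∈ℤ_+^d} (ℒh_γ)(x)/h_γ(x) = − (1 − (d−1)p²/(1−(d−2)p)) · min_{1≤i≤d} γ_i (μ_i/(1+γ_i) − ν_i) < 0. -/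

import Mathlib

open scoped BigOperators
open Filter

/-- The `i`-th standard unit vector in `ℤ^d`. -/
def unitZ {d : ℕ} (i : Fin d) : Fin d → ℤ := fun k => if k = i then 1 else 0

/-- The jump rates `q(y)` of the Jackson network: `q(ε^i) = λ_i`,
`q(-ε^i) = μ_i p_{i0}`, `q(ε^j - ε^i) = μ_i p_{ij}` and `q(y) = 0` otherwise. -/
noncomputable def qrate {d : ℕ} (lam mu : Fin d → ℝ) (P : Fin d → Fin d → ℝ)
    (y : Fin d → ℤ) : ℝ :=
  (∑ i, lam i * (if y = unitZ i then 1 else 0))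
    + (∑ i, mu i * (1 - ∑ j, P i j) * (if y = -unitZ i then 1 else 0))
    + (∑ i, ∑ j, mu i * P i j * (if y = unitZ j - unitZ i then 1 else 0))

/-- Assumption (A): irreducibility of the matrix `(q(x - y); x, y ∈ ℤ^d)`. -/
def AssumptionA {d : ℕ} (lam mu : Fin d → ℝ) (P : Fin d → Fin d → ℝ) : Prop :=
  ∀ x y : Fin d → ℤ, ∃ (n : ℕ) (c : Fin (n + 1) → Fin d → ℤ),
    c 0 = x ∧ c (Fin.last n) = y ∧
      ∀ k : Fin n, 0 < qrate lam mu P (c k.succ - c k.castSucc)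

/-- The generator `ℒ` of the Jackson network:
`(ℒ f)(x) = ∑_{z ∈ ℤ_+^d} q(z - x) (f z - f x)`. -/
noncomputable def gen {d : ℕ} (lam mu : Fin d → ℝ) (P : Fin d → Fin d → ℝ)
    (f : (Fin d → ℕ) → ℝ) (x : Fin d → ℕ) : ℝ :=
  ∑' z : Fin d → ℕ, qrate lam mu P (fun k => (z k : ℤ) - (x k : ℤ)) * (f z - f x)

/-- The hitting-probability matrix `Q j i = G j i / G i i`. -/
noncomputable def hitQ {d : ℕ} (G : Fin d → Fin d → ℝ) : Fin d → Fin d → ℝ :=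
  fun j i => G j i / G i i

/-- The vector `γ⃗_i`, with components `γ_i^j = log (1 + Q j i * γ i)`. -/
noncomputable def gvec {d : ℕ} (Q : Fin d → Fin d → ℝ) (γ : Fin d → ℝ) (i j : Fin d) : ℝ :=
  Real.log (1 + Q j i * γ i)

/-- The set `Γ`: all `γ ∈ ℝ_+^d` such that for every `i` and every nonzero
`v ∈ ℝ_+^d` with `v i = 0` one has `γ⃗_i ⬝ v < max_j γ⃗_j ⬝ v`. -/
def GammaSet (d : ℕ) (Q : Fin d → Fin d → ℝ) : Set (Fin d → ℝ) :=
  {γ | (∀ i, 0 ≤ γ i) ∧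
    ∀ i : Fin d, ∀ v : Fin d → ℝ, (∀ j, 0 ≤ v j) → v ≠ 0 → v i = 0 →
      (∑ j, gvec Q γ i j * v j) < ⨆ l : Fin d, ∑ j, gvec Q γ l j * v j}

/-- The function Σ(γ_1,…,γ_d) for the completely symmetric routing matrix, where
qq = p / (1 - (d-2)p) is the common off-diagonal hitting probability. -/
noncomputable def SigmaFun {d : ℕ} (qq : ℝ) (γ : Fin d → ℝ) : ℝ :=
  ∑ j, ((⨆ i : Fin d, Real.log (1 + qq * γ i)) - Real.log (1 + qq * γ j))
        / (Real.log (1 + γ j) - Real.log (1 + qq * γ j))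

/-- The multiplicative function `y ↦ ∏ k, a k ^ y k` on `ℤ^d`. -/
noncomputable def zmonomial {d : ℕ} (a : Fin d → ℝ) (y : Fin d → ℤ) : ℝ := ∏ k, a k ^ y k

lemma zmonomial_add {d : ℕ} {a : Fin d → ℝ} (ha : ∀ k, 0 < a k) (y z : Fin d → ℤ) :
    zmonomial a (y + z) = zmonomial a y * zmonomial a z := by
  simp only [zmonomial, ← Finset.prod_mul_distrib, Pi.add_apply]
  exact Finset.prod_congr rfl fun k _ => zpow_add₀ (ha k).ne' _ _

lemma zmonomial_neg {d : ℕ} (a : Fin d → ℝ) (y : Fin d → ℤ) :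
    zmonomial a (-y) = (zmonomial a y)⁻¹ := by
  simp [zmonomial]

lemma zmonomial_unitZ {d : ℕ} (a : Fin d → ℝ) (i : Fin d) : zmonomial a (unitZ i) = a i := by
  unfold zmonomial unitZ
  rw [Finset.prod_eq_single i] <;> simp +contextual

lemma zmonomial_natCast {d : ℕ} (a : Fin d → ℝ) (x : Fin d → ℕ) :
    zmonomial a (fun k => (x k : ℤ)) = ∏ k, a k ^ x k := by
  simp [zmonomial]

open Classical in
lemma hasSum_jump {d : ℕ} {a : Fin d → ℝ} (ha : ∀ k, 0 < a k) (x : Fin d → ℕ)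
    (y : Fin d → ℤ) :
    HasSum (fun z : Fin d → ℕ => (if (fun k => (z k : ℤ) - (x k : ℤ)) = y then (1 : ℝ) else 0)
        * ((∏ k, a k ^ z k) - ∏ k, a k ^ x k))
      (if ∀ k, 0 ≤ (x k : ℤ) + y k then (∏ k, a k ^ x k) * (zmonomial a y - 1) else 0) := by
  split_ifs with h
  · have hz : (fun k => (((x k : ℤ) + y k).toNat : ℤ)) = (fun k => (x k : ℤ)) + y := by
      funext k
      simp [Int.toNat_of_nonneg (h k)]
    convert hasSum_single (fun k => ((x k : ℤ) + y k).toNat) ?_ using 1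
    · rw [if_pos, ← zmonomial_natCast, ← zmonomial_natCast, hz, zmonomial_add ha]
      · ring
      · funext k
        have := congrFun hz k
        simp only [Pi.add_apply] at this
        rw [this]; ring
    · intro z hzne
      rw [if_neg, zero_mul]
      rintro rfl
      exact hzne (by funext k; simp)
  · convert hasSum_zero using 2 with z
    rw [if_neg, zero_mul]
    rintro rfl
    exact h fun k => by simp

lemma nonneg_add_neg_unitZ {d : ℕ} (x : Fin d → ℕ) (i : Fin d) :
    (∀ k, 0 ≤ (x k : ℤ) + (-unitZ i) k) ↔ 0 < x i := by
  constructor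
  · intro h
    have := h i
    simp [unitZ] at this
    omega
  · intro h k
    by_cases hk : k = i
    · subst hk; simp [unitZ]; omega
    · simp [unitZ, hk]

lemma nonneg_add_unitZ_sub_unitZ {d : ℕ} (x : Fin d → ℕ) {i j : Fin d} (hij : i ≠ j) :
    (∀ k, 0 ≤ (x k : ℤ) + (unitZ j - unitZ i) k) ↔ 0 < x i := by
  constructor
  · intro h
    have := h i
    simp [unitZ, hij] at this
    omega
  · intro h k
    by_cases hk : k = i
    · subst hk; simp [unitZ, hij]; omega
    · simp only [unitZ, Pi.sub_apply, hk, if_false]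
      split_ifs <;> omega

/-- The generator acts on a geometric function by a multiplication operator. -/
lemma hasSum_gen_geometric {d : ℕ} (lam mu : Fin d → ℝ) (P : Fin d → Fin d → ℝ)
    {a : Fin d → ℝ} (ha : ∀ k, 0 < a k) (x : Fin d → ℕ) :
    HasSum (fun z : Fin d → ℕ => qrate lam mu P (fun k => (z k : ℤ) - (x k : ℤ))
        * ((∏ k, a k ^ z k) - ∏ k, a k ^ x k))
      ((∏ k, a k ^ x k) * ((∑ i, lam i * (a i - 1)) + ∑ i, (if 0 < x i then
        mu i * ((1 - ∑ j, P i j) * ((a i)⁻¹ - 1) + ∑ j, P i j * (a j / a i - 1)) else 0))) := by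
  classical
  have h1 : ∀ i, HasSum (fun z : Fin d → ℕ =>
      lam i * (if (fun k => (z k : ℤ) - (x k : ℤ)) = unitZ i then (1 : ℝ) else 0)
        * ((∏ k, a k ^ z k) - ∏ k, a k ^ x k))
      (lam i * ((∏ k, a k ^ x k) * (a i - 1))) := by
    intro i
    have := (hasSum_jump ha x (unitZ i)).mul_left (lam i)
    rw [if_pos, zmonomial_unitZ] at this
    · simpa only [mul_assoc] using this
    · intro k
      unfold unitZ
      split_ifs <;> omega
  have h2 : ∀ i, HasSum (fun z : Fin d → ℕ =>
      mu i * (1 - ∑ j, P i j)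
        * (if (fun k => (z k : ℤ) - (x k : ℤ)) = -unitZ i then (1 : ℝ) else 0)
        * ((∏ k, a k ^ z k) - ∏ k, a k ^ x k))
      (mu i * (1 - ∑ j, P i j) * (if 0 < x i then (∏ k, a k ^ x k) * ((a i)⁻¹ - 1) else 0)) := by
    intro i
    have := (hasSum_jump ha x (-unitZ i)).mul_left (mu i * (1 - ∑ j, P i j))
    simp only [nonneg_add_neg_unitZ, zmonomial_neg, zmonomial_unitZ] at this
    simpa only [mul_assoc] using this
  have h3 : ∀ i j, HasSum (fun z : Fin d → ℕ =>
      mu i * P i j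
        * (if (fun k => (z k : ℤ) - (x k : ℤ)) = unitZ j - unitZ i then (1 : ℝ) else 0)
        * ((∏ k, a k ^ z k) - ∏ k, a k ^ x k))
      (mu i * P i j * (if 0 < x i then (∏ k, a k ^ x k) * (a j / a i - 1) else 0)) := by
    intro i j
    have := (hasSum_jump ha x (unitZ j - unitZ i)).mul_left (mu i * P i j)
    have hz : zmonomial a (unitZ j - unitZ i) = a j / a i := by
      rw [sub_eq_add_neg, zmonomial_add ha, zmonomial_neg, zmonomial_unitZ, zmonomial_unitZ,
        div_eq_mul_inv]
    rw [hz] at this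
    by_cases hij : i = j
    · subst hij
      simpa only [mul_assoc, div_self (ha i).ne', sub_self, mul_zero, ite_self] using this
    · simp only [nonneg_add_unitZ_sub_unitZ x hij] at this
      simpa only [mul_assoc] using this
  have h := ((hasSum_sum (s := Finset.univ) fun i _ => h1 i).add
    (hasSum_sum (s := Finset.univ) fun i _ => h2 i)).add
    (hasSum_sum (s := Finset.univ) fun i _ => hasSum_sum (s := Finset.univ) fun j _ => h3 i j)
  convert h using 1
  · funext z
    simp only [qrate, add_mul, Finset.sum_mul]
  · rw [mul_add, add_assoc, ← Finset.sum_add_distrib, Finset.mul_sum, Finset.mul_sum]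
    congr 1
    · exact Finset.sum_congr rfl fun i _ => by ring
    · refine Finset.sum_congr rfl fun i _ => ?_
      split_ifs
      · have : ∑ j, mu i * P i j * ((∏ k, a k ^ x k) * (a j / a i - 1))
            = mu i * (∏ k, a k ^ x k) * ∑ j, P i j * (a j / a i - 1) := by
          rw [Finset.mul_sum]
          exact Finset.sum_congr rfl fun j _ => by ring
        rw [this]
        ring
      · simp

lemma tendsto_sum_cofinite_atTop (d : ℕ) :
    Tendsto (fun x : Fin d → ℕ => ∑ j, x j) cofinite atTop := by
  rw [tendsto_atTop]
  intro n
  rw [eventually_cofinite]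
  refine (Set.finite_Iic (fun _ : Fin d => n)).subset fun x hx j => ?_
  simp only [not_le, Set.mem_ofPred_eq] at hx
  exact (Finset.single_le_sum (fun k _ => Nat.zero_le (x k)) (Finset.mem_univ j)).trans hx.le

/-- If `∑ (M - β) / (α - β) < 1`, some exponent beats the rate `M` by a uniform margin. -/
lemma exists_uniform_margin {d : ℕ} {α β : Fin d → ℝ} {M : ℝ} (hαβ : ∀ j, β j < α j)
    (hsum : ∑ j, (M - β j) / (α j - β j) < 1) :
    ∃ δ : ℝ, 0 < δ ∧ ∀ x : Fin d → ℝ, 0 < ∑ j, x j →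
      ∃ l, (M + δ) * ∑ j, x j ≤ β l * (∑ j, x j) + (α l - β l) * x l := by
  have hK : 0 ≤ ∑ j, 1 / (α j - β j) :=
    Finset.sum_nonneg fun j _ => (one_div_pos.2 (sub_pos.2 (hαβ j))).le
  set K := ∑ j, 1 / (α j - β j) with hKdef
  set S := ∑ j, (M - β j) / (α j - β j) with hSdef
  refine ⟨(1 - S) / (K + 1), div_pos (by linarith) (by linarith), fun x hx => ?_⟩
  set δ := (1 - S) / (K + 1) with hδ
  have hδpos : 0 < δ := div_pos (by linarith) (by linarith)
  have hδK : δ * (K + 1) = 1 - S := div_mul_cancel₀ _ (by linarith)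
  by_contra! hcon
  set X := ∑ j, x j with hX
  have hle : X ≤ ∑ j, ((M - β j) / (α j - β j) * X + δ * X * (1 / (α j - β j))) := by
    refine Finset.sum_le_sum fun j _ => ?_
    have hj : 0 < α j - β j := sub_pos.2 (hαβ j)
    rw [show (M - β j) / (α j - β j) * X + δ * X * (1 / (α j - β j))
      = ((M + δ) * X - β j * X) / (α j - β j) by ring, le_div_iff₀ hj]
    linarith [hcon j]
  rw [Finset.sum_add_distrib, ← Finset.sum_mul, ← Finset.mul_sum, ← hKdef, ← hSdef] at hle
  nlinarith [mul_pos hδpos hx]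

lemma limsup_eq_of_eventually_le_of_frequently_ge {ι : Type*} {l : Filter ι} {u v : ι → ℝ}
    {L : ℝ} (huv : ∀ᶠ x in l, u x ≤ v x) (hv : Tendsto v l (nhds L))
    (hu : ∃ᶠ x in l, L ≤ u x) : limsup u l = L := by
  have hup : ∀ b > L, ∀ᶠ x in l, u x ≤ b := fun b hb =>
    ((hv.eventually_lt_const hb).and huv).mono fun x h => h.2.trans h.1.le
  have hbdd : IsBoundedUnder (· ≤ ·) l u := ⟨L + 1, hup _ (by linarith)⟩
  exact le_antisymm (le_of_forall_gt_imp_ge_of_dense fun b hb =>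
      limsup_le_of_le (IsCoboundedUnder.of_frequently_ge hu) (hup b hb))
    (le_limsup_of_frequently_le hu hbdd)

lemma sum_symmetric_mul {d : ℕ} {P : Fin d → Fin d → ℝ} {p : ℝ} (hPdiag : ∀ i, P i i = 0)
    (hsym : ∀ i j : Fin d, i ≠ j → P i j = p) (k : Fin d) (b : Fin d → ℝ) :
    ∑ j, P k j * b j = p * ((∑ j, b j) - b k) := by
  rw [← Finset.add_sum_erase _ _ (Finset.mem_univ k), ← Finset.add_sum_erase _ b (Finset.mem_univ k),
    hPdiag, zero_mul, zero_add, add_sub_cancel_left, Finset.mul_sum]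
  exact Finset.sum_congr rfl fun j hj => by rw [hsym k j (Finset.ne_of_mem_erase hj).symm]

lemma arrival_rate_eq {d : ℕ} {P : Fin d → Fin d → ℝ} {p : ℝ} (hPdiag : ∀ i, P i i = 0)
    (hsym : ∀ i j : Fin d, i ≠ j → P i j = p) {lam ν : Fin d → ℝ}
    (hν : ∀ j, ν j = lam j + ∑ i, ν i * P i j) (j : Fin d) :
    lam j = ν j - p * ((∑ i, ν i) - ν j) := by
  have hPT : ∀ i, P i j = P j i := fun i => by
    by_cases h : i = j
    · rw [h]
    · rw [hsym i j h, hsym j i (Ne.symm h)]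
  rw [← sum_symmetric_mul hPdiag hsym j ν, eq_sub_iff_add_eq]
  rw [hν j]
  exact congrArg _ (Finset.sum_congr rfl fun i _ => by rw [hPT i, mul_comm])

/-- The base `1 + Q j i * γ i` of the geometric function attached to station `i`. -/
noncomputable def symBase {d : ℕ} (q : ℝ) (γ : Fin d → ℝ) (i j : Fin d) : ℝ :=
  1 + γ i * if j = i then 1 else q

lemma symBase_self {d : ℕ} (q : ℝ) (γ : Fin d → ℝ) (i : Fin d) :
    symBase q γ i i = 1 + γ i := by
  simp [symBase]

lemma symBase_of_ne {d : ℕ} (q : ℝ) (γ : Fin d → ℝ) {i j : Fin d} (h : j ≠ i) :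
    symBase q γ i j = 1 + q * γ i := by
  simp [symBase, h, mul_comm]

lemma symBase_pos {d : ℕ} {q : ℝ} (hq : 0 < q) {γ : Fin d → ℝ} (hγ : ∀ i, 0 < γ i)
    (i j : Fin d) : 0 < symBase q γ i j := by
  have := hγ i
  unfold symBase
  split_ifs <;> positivity

lemma prod_symBase_pow {d : ℕ} (q : ℝ) (γ : Fin d → ℝ) (i : Fin d) (x : Fin d → ℕ) :
    ∏ k, symBase q γ i k ^ x k
      = (1 + γ i) ^ x i * (1 + q * γ i) ^ ∑ j ∈ Finset.univ.erase i, x j := by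
  rw [← Finset.mul_prod_erase _ _ (Finset.mem_univ i), symBase_self, ← Finset.prod_pow_eq_pow_sum]
  exact congrArg _ (Finset.prod_congr rfl fun j hj => by
    rw [symBase_of_ne q γ (Finset.ne_of_mem_erase hj)])

lemma sum_symBase_weights {d : ℕ} (q : ℝ) (i : Fin d) (b : Fin d → ℝ) :
    ∑ j, b j * (if j = i then 1 else q) = q * (∑ j, b j) + (1 - q) * b i := by
  have : ∀ j, b j * (if j = i then 1 else q) = q * b j + (1 - q) * if j = i then b j else 0 := by
    intro j
    split_ifs <;> ring
  simp only [this, Finset.sum_add_distrib, ← Finset.mul_sum, Finset.sum_ite_eq', Finset.mem_univ,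
    if_true]

/-- The arrival part of the generator on the geometric function of station `i`. -/
lemma sum_arrivals_symBase {d : ℕ} {P : Fin d → Fin d → ℝ} {p q : ℝ} (hPdiag : ∀ i, P i i = 0)
    (hsym : ∀ i j : Fin d, i ≠ j → P i j = p) {lam ν : Fin d → ℝ}
    (hν : ∀ j, ν j = lam j + ∑ i, ν i * P i j) (hq : q = p * (1 + ((d : ℝ) - 2) * q))
    (γ : Fin d → ℝ) (i : Fin d) :
    ∑ j, lam j * (symBase q γ i j - 1) = (1 - q) * (1 + p) * γ i * ν i := by
  have h1 : ∀ j, lam j * (symBase q γ i j - 1) = γ i * (lam j * if j = i then 1 else q) :=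
    fun j => by unfold symBase; ring
  have h2 : ∑ j, lam j = (1 + p - d * p) * ∑ j, ν j := by
    simp only [arrival_rate_eq hPdiag hsym hν, mul_sub, Finset.sum_sub_distrib, ← Finset.mul_sum,
      Finset.sum_const, Finset.card_univ, Fintype.card_fin, nsmul_eq_mul]
    ring
  simp only [h1, ← Finset.mul_sum, sum_symBase_weights, h2]
  rw [arrival_rate_eq hPdiag hsym hν i]
  linear_combination (γ i * ∑ j, ν j) * hq

/-- The service part of the generator on the geometric function of station `i`. -/
lemma service_symBase {d : ℕ} {P : Fin d → Fin d → ℝ} {p q : ℝ} (hPdiag : ∀ i, P i i = 0)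
    (hsym : ∀ i j : Fin d, i ≠ j → P i j = p) (hq : q = p * (1 + ((d : ℝ) - 2) * q))
    {γ : Fin d → ℝ} (hpos : ∀ i j, 0 < symBase q γ i j) (i k : Fin d) :
    (1 - ∑ j, P k j) * ((symBase q γ i k)⁻¹ - 1)
        + ∑ j, P k j * (symBase q γ i j / symBase q γ i k - 1)
      = if k = i then -((1 - q) * (1 + p) * γ i / (1 + γ i)) else 0 := by
  have ha := (hpos i k).ne'
  have h1 : ∀ j, P k j * (symBase q γ i j / symBase q γ i k - 1)
      = P k j * (γ i * if j = i then 1 else q) * (symBase q γ i k)⁻¹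
        + P k j * ((symBase q γ i k)⁻¹ - 1) := fun j => by
    rw [symBase.eq_def q γ i j]; field_simp; ring
  have h2 : ∑ j : Fin d, (if j = i then (1 : ℝ) else q) = q * d + (1 - q) := by
    simpa using sum_symBase_weights q i (fun _ => (1 : ℝ))
  rw [Finset.sum_congr rfl fun j _ => h1 j, Finset.sum_add_distrib, ← Finset.sum_mul,
    ← Finset.sum_mul, sum_symmetric_mul hPdiag hsym k fun j => γ i * if j = i then 1 else q,
    ← Finset.mul_sum, h2]
  generalize ∑ j, P k j = t
  split_ifs with h
  · subst h
    rw [symBase_self] at ha ⊢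
    field_simp
    linear_combination -(γ k) * hq
  · rw [symBase_of_ne q γ h] at ha ⊢
    field_simp
    linear_combination -(γ i) * hq

lemma gen_sum_symBase {d : ℕ} {lam mu : Fin d → ℝ} {P : Fin d → Fin d → ℝ} {p q : ℝ}
    (hPdiag : ∀ i, P i i = 0) (hsym : ∀ i j : Fin d, i ≠ j → P i j = p) {ν : Fin d → ℝ}
    (hν : ∀ j, ν j = lam j + ∑ i, ν i * P i j) (hq : q = p * (1 + ((d : ℝ) - 2) * q))
    {γ : Fin d → ℝ} (hpos : ∀ i j, 0 < symBase q γ i j) (x : Fin d → ℕ) :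
    gen lam mu P (fun y => ∑ i, ∏ k, symBase q γ i k ^ y k) x
      = ∑ i, (∏ k, symBase q γ i k ^ x k) * ((1 - q) * (1 + p) *
        (γ i * (ν i - if 0 < x i then mu i / (1 + γ i) else 0))) := by
  have h := hasSum_sum (s := Finset.univ) fun i _ =>
    hasSum_gen_geometric lam mu P (hpos i) x
  simp only [← Finset.mul_sum, Finset.sum_sub_distrib] at h
  refine h.tsum_eq.trans (Finset.sum_congr rfl fun i _ => ?_)
  rw [sum_arrivals_symBase hPdiag hsym hν hq]
  simp only [service_symBase hPdiag hsym hq hpos]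
  rw [Finset.sum_eq_single i (fun k _ hk => by simp [hk]) (by simp), if_pos rfl]
  split_ifs <;> ring

lemma prod_symBase_pow_eq_exp {d : ℕ} {q : ℝ} (hq : 0 < q) {γ : Fin d → ℝ} (hγ : ∀ i, 0 < γ i)
    (i : Fin d) (x : Fin d → ℕ) :
    ∏ k, symBase q γ i k ^ x k = Real.exp (Real.log (1 + q * γ i) * (∑ j, (x j : ℝ))
      + (Real.log (1 + γ i) - Real.log (1 + q * γ i)) * x i) := by
  have h1 : 0 < 1 + γ i := by linarith [hγ i]
  have h2 : 0 < 1 + q * γ i := by linarith [mul_pos hq (hγ i)]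
  rw [prod_symBase_pow, ← Finset.add_sum_erase _ _ (Finset.mem_univ i)]
  nth_rewrite 1 [← Real.exp_log h1]
  nth_rewrite 1 [← Real.exp_log h2]
  rw [← Real.exp_nat_mul, ← Real.exp_nat_mul, ← Real.exp_add]
  push_cast
  congr 1
  ring

/-- Where the `i`-th coordinate vanishes, the `i`-th geometric function is exponentially
negligible. -/
lemma exists_exp_decay {d : ℕ} {q : ℝ} (hq0 : 0 < q) (hq1 : q < 1) {γ : Fin d → ℝ}
    (hγ : ∀ i, 0 < γ i) (hS : SigmaFun q γ < 1) :
    ∃ δ : ℝ, 0 < δ ∧ ∀ (x : Fin d → ℕ) (i : Fin d), x i = 0 →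
      ∏ k, symBase q γ i k ^ x k
        ≤ Real.exp (-δ * ∑ j, (x j : ℝ)) * ∑ l, ∏ k, symBase q γ l k ^ x k := by
  have hlt : ∀ j, Real.log (1 + q * γ j) < Real.log (1 + γ j) := fun j =>
    Real.log_lt_log (by nlinarith [hγ j]) (by nlinarith [hγ j])
  obtain ⟨δ, hδ, hmargin⟩ := exists_uniform_margin hlt hS
  refine ⟨δ, hδ, fun x i hxi => ?_⟩
  have hle : ∀ l, ∏ k, symBase q γ l k ^ x k ≤ ∑ l, ∏ k, symBase q γ l k ^ x k := fun l =>
    Finset.single_le_sum (f := fun l => ∏ k, symBase q γ l k ^ x k)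
      (fun m _ => Finset.prod_nonneg fun k _ => pow_nonneg (symBase_pos hq0 hγ m k).le _)
      (Finset.mem_univ l)
  have hX : 0 ≤ ∑ j, (x j : ℝ) := Finset.sum_nonneg fun j _ => Nat.cast_nonneg _
  rcases hX.eq_or_lt with h0 | hpos
  · rw [← h0]
    simpa using hle i
  · obtain ⟨l, hl⟩ := hmargin (fun j => (x j : ℝ)) hpos
    refine le_trans ?_ (mul_le_mul_of_nonneg_left (hle l) (Real.exp_pos _).le)
    rw [prod_symBase_pow_eq_exp hq0 hγ, prod_symBase_pow_eq_exp hq0 hγ, ← Real.exp_add,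
      Real.exp_le_exp, hxi]
    have hM : Real.log (1 + q * γ i) ≤ ⨆ j, Real.log (1 + q * γ j) :=
      le_ciSup (Set.finite_range fun j => Real.log (1 + q * γ j)).bddAbove i
    push_cast
    nlinarith [mul_le_mul_of_nonneg_right hM hX]

lemma frequently_cofinite_single {d : ℕ} (i : Fin d) {p : (Fin d → ℕ) → Prop}
    (h : ∀ n, p (Pi.single i n)) : ∃ᶠ x in cofinite, p x := by
  have hs : Tendsto (fun n : ℕ => (Pi.single i n : Fin d → ℕ)) cofinite cofinite :=
    (Pi.single_injective i).tendsto_cofinite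
  exact hs.frequently (Eventually.of_forall h).frequently

lemma limsup_generator_ratio {d : ℕ} {q c : ℝ} (hq0 : 0 < q) (hq1 : q < 1) (hc : 0 < c)
    {γ mu ν : Fin d → ℝ} (hγ : ∀ i, 0 < γ i) (hν : ∀ i, 0 < ν i) (hmu : ∀ i, 0 < mu i)
    (hS : SigmaFun q γ < 1) {m : ℝ} (hm : 0 ≤ m)
    (hle : ∀ i, m ≤ γ i * (mu i / (1 + γ i) - ν i)) {i₀ : Fin d}
    (hi₀ : γ i₀ * (mu i₀ / (1 + γ i₀) - ν i₀) = m) :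
    limsup (fun x : Fin d → ℕ => (∑ i, (∏ k, symBase q γ i k ^ x k) * (c *
        (γ i * (ν i - if 0 < x i then mu i / (1 + γ i) else 0))))
          / ∑ i, ∏ k, symBase q γ i k ^ x k) cofinite = -(c * m) := by
  obtain ⟨δ, hδ, hdecay⟩ := exists_exp_decay hq0 hq1 hγ hS
  have hf : ∀ (x : Fin d → ℕ) i, 0 < ∏ k, symBase q γ i k ^ x k := fun x i =>
    Finset.prod_pos fun k _ => pow_pos (symBase_pos hq0 hγ i k) _
  have hH : ∀ x : Fin d → ℕ, 0 < ∑ i, ∏ k, symBase q γ i k ^ x k := fun x =>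
    Finset.sum_pos (fun i _ => hf x i) ⟨i₀, Finset.mem_univ _⟩
  have hr : ∀ i, 0 < mu i / (1 + γ i) := fun i => div_pos (hmu i) (by linarith [hγ i])
  refine limsup_eq_of_eventually_le_of_frequently_ge
    (v := fun x => -(c * m)
      + (∑ i, c * (γ i * (mu i / (1 + γ i)))) * Real.exp (-δ * ∑ j, (x j : ℝ)))
    (Eventually.of_forall fun x => ?_) ?_ (frequently_cofinite_single i₀ fun n => ?_)
  · rw [div_le_iff₀ (hH x), add_mul, Finset.mul_sum, mul_assoc, Finset.sum_mul,
      ← Finset.sum_add_distrib]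
    refine Finset.sum_le_sum fun i _ => ?_
    have hA : 0 < c * (γ i * (mu i / (1 + γ i))) := mul_pos hc (mul_pos (hγ i) (hr i))
    have hcm := mul_le_mul_of_nonneg_left (hle i) (mul_pos hc (hf x i)).le
    split_ifs with hxi
    · have := mul_pos hA (mul_pos (Real.exp_pos (-δ * ∑ j, (x j : ℝ))) (hH x))
      linarith
    · have := mul_le_mul_of_nonneg_left (hdecay x i (by omega)) hA.le
      linarith
  · have hX : Tendsto (fun x : Fin d → ℕ => ∑ j, (x j : ℝ)) cofinite atTop := by
      simpa [Function.comp_def] using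
        (tendsto_natCast_atTop_atTop (R := ℝ)).comp (tendsto_sum_cofinite_atTop d)
    have hE : Tendsto (fun x : Fin d → ℕ => Real.exp (-δ * ∑ j, (x j : ℝ))) cofinite (nhds 0) :=
      Real.tendsto_exp_atBot.comp (hX.const_mul_atTop_of_neg (neg_lt_zero.2 hδ))
    simpa using (hE.const_mul (∑ i, c * (γ i * (mu i / (1 + γ i))))).const_add (-(c * m))
  · rw [le_div_iff₀ (hH _), Finset.mul_sum]
    refine Finset.sum_le_sum fun i _ => ?_
    have hfi := mul_pos hc (hf (Pi.single i₀ n) i)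
    by_cases hi : i = i₀
    · subst hi
      rw [← hi₀]
      split_ifs
      · linarith
      · nlinarith [mul_pos hfi (mul_pos (hγ i) (hr i))]
    · rw [if_neg (by simp [hi])]
      nlinarith [mul_pos hfi (mul_pos (hγ i) (hν i)), mul_nonneg hfi.le hm]

/-- Corollary 3.2: for completely symmetric routing, if Σ(γ) < 1 and
0 < γ_i < μ_i/ν_i - 1 for all i, then
h_γ(x) = Σ_i (1+γ_i)^{x_i} (1+qγ_i)^{Σ_{j≠i} x_j} satisfies
limsup (ℒ h_γ)(x)/h_γ(x)
  = -(1 - (d-1)p²/(1-(d-2)p)) min_i γ_i (μ_i/(1+γ_i) - ν_i) < 0. -/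
theorem stmt12
    (d : ℕ) (hd : 0 < d)
    (lam mu : Fin d → ℝ) (P : Fin d → Fin d → ℝ)
    (hlam : ∀ i, 0 ≤ lam i) (hmu : ∀ i, 0 < mu i)
    (hP : ∀ i j, 0 ≤ P i j) (hPdiag : ∀ i, P i i = 0) (hP0 : ∀ i, ∑ j, P i j ≤ 1)
    (hA : AssumptionA lam mu P)
    (ν : Fin d → ℝ) (hν : ∀ j, ν j = lam j + ∑ i, ν i * P i j) (hνpos : ∀ i, 0 < ν i)
    (hB : ∀ i, ν i < mu i)
    (p : ℝ) (hp : 0 < p) (hpd : p < 1 / ((d : ℝ) - 1))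
    (hsym : ∀ i j : Fin d, i ≠ j → P i j = p)
    (γ : Fin d → ℝ) (hγpos : ∀ i, 0 < γ i) (hγlt : ∀ i, γ i < mu i / ν i - 1)
    (hSigma : SigmaFun (p / (1 - ((d : ℝ) - 2) * p)) γ < 1) :
    Filter.limsup
        (fun x : Fin d → ℕ =>
          gen lam mu P
              (fun y => ∑ i, (1 + γ i) ^ (y i)
                * (1 + p / (1 - ((d : ℝ) - 2) * p) * γ i) ^ (∑ j ∈ Finset.univ.erase i, y j)) x
            / ∑ i, (1 + γ i) ^ (x i)
                * (1 + p / (1 - ((d : ℝ) - 2) * p) * γ i) ^ (∑ j ∈ Finset.univ.erase i, x j))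
        Filter.cofinite
      = -((1 - ((d : ℝ) - 1) * p ^ 2 / (1 - ((d : ℝ) - 2) * p))
            * ⨅ i : Fin d, γ i * (mu i / (1 + γ i) - ν i))
    ∧ 0 < (1 - ((d : ℝ) - 1) * p ^ 2 / (1 - ((d : ℝ) - 2) * p))
            * ⨅ i : Fin d, γ i * (mu i / (1 + γ i) - ν i) := by
  have hd2 : (2 : ℝ) ≤ d := by
    have h2 : 2 ≤ d := by
      by_contra! h
      have h1 : d = 1 := by omega
      rw [h1] at hpd
      norm_num at hpd
      linarith
    exact_mod_cast h2
  have hpd' : p * ((d : ℝ) - 1) < 1 := (lt_div_iff₀ (by linarith)).1 hpd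
  have hD : 0 < 1 - ((d : ℝ) - 2) * p := by nlinarith
  have hqeq : p / (1 - ((d : ℝ) - 2) * p)
      = p * (1 + ((d : ℝ) - 2) * (p / (1 - ((d : ℝ) - 2) * p))) := by
    linear_combination div_mul_cancel₀ p hD.ne'
  have hc : 1 - ((d : ℝ) - 1) * p ^ 2 / (1 - ((d : ℝ) - 2) * p)
      = (1 - p / (1 - ((d : ℝ) - 2) * p)) * (1 + p) := by
    linear_combination hqeq
  have hq0 : 0 < p / (1 - ((d : ℝ) - 2) * p) := div_pos hp hD
  have hq1 : p / (1 - ((d : ℝ) - 2) * p) < 1 := (div_lt_one hD).2 (by linarith)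
  rw [hc]
  generalize p / (1 - ((d : ℝ) - 2) * p) = q at *
  have hcpos : 0 < (1 - q) * (1 + p) := mul_pos (by linarith) (by linarith)
  have : Nonempty (Fin d) := ⟨⟨0, hd⟩⟩
  obtain ⟨i₀, hi₀⟩ := exists_eq_ciInf_of_finite
    (f := fun i : Fin d => γ i * (mu i / (1 + γ i) - ν i))
  have hθ : ∀ i, 0 < γ i * (mu i / (1 + γ i) - ν i) := fun i => by
    have h1 : 0 < 1 + γ i := by linarith [hγpos i]
    have h2 : (1 + γ i) * ν i < mu i := (lt_div_iff₀ (hνpos i)).1 (by linarith [hγlt i])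
    exact mul_pos (hγpos i) (sub_pos.2 ((lt_div_iff₀ h1).2 (by linarith)))
  have hm : 0 < ⨅ i : Fin d, γ i * (mu i / (1 + γ i) - ν i) := hi₀ ▸ hθ i₀
  refine ⟨?_, mul_pos hcpos hm⟩
  simp only [← prod_symBase_pow]
  simp only [gen_sum_symBase hPdiag hsym hν hqeq (symBase_pos hq0 hγpos)]
  exact limsup_generator_ratio hq0 hq1 hcpos hγpos hνpos hmu hSigma hm.le
    (fun i => ciInf_le (Set.finite_range _).bddBelow i) hi₀
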